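/- arXiv:0708.0234 — 3 statements merged into one kernel-verified Lean document; each statement's English description precedes it below -/
import Mathlib

section
/- Let N ∈ ℕ and let C^A_{BC} (A,B,C = 1,…,N) be real constants, antisymmetric in the lower indices (C^A_{BC} = −C^A_{CB}), such that the N×N matrices C_A with entries (C_A)^B_C = C^B_{AC} satisfy [C_A, C_B] = Σ_C C^C_{AB} C_C. For k ∈ ℝ^N set C(k) := Σ_A k^A C_A and Y(k) := Σ_{j≥0} (−1)^j C(k)^j/(j+1)!; on the open set U := {k : Y(k) invertible} define X_A{}^M(k) by Σ_M Y^B_M(k) X_A{}^M(k) = δ^B_A. Then on U the vector fields X_A := Σ_M X_A{}^M ∂/∂k^M satisfy [X_A, X_B] = Σ_C C^C_{AB} X_C; explicitly, for all k ∈ U and all A, B, N: Σ_M (X_A{}^M(k) ∂X_B{}^N/∂k^M (k) − X_B{}^M(k) ∂X_A{}^N/∂k^M (k)) = Σ_C C^C_{AB} X_C{}^N(k). -/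
open Matrix

/-- Partial derivative `∂/∂k^M` of a real-valued function on `ℝ^N`. -/
noncomputable def partialDeriv' {N : ℕ} (f : (Fin N → ℝ) → ℝ) (M : Fin N) (k : Fin N → ℝ) : ℝ :=
  fderiv ℝ f k (Pi.single M 1)

section ExpQuotient

open Filter Topology Nat

variable {𝔸 : Type*} [NormedRing 𝔸] [NormedAlgebra ℝ 𝔸]

/-- The entire function `(1 - exp (-a)) / a`, defined by its power series. -/
noncomputable def oneSubExpNegDiv (a : 𝔸) : 𝔸 :=
  ∑' j : ℕ, ((-1 : ℝ) ^ j / (j + 1)!) • a ^ j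

variable [CompleteSpace 𝔸]

theorem contDiff_oneSubExpNegDiv {n : WithTop ℕ∞} :
    ContDiff ℝ n (oneSubExpNegDiv : 𝔸 → 𝔸) := by
  set c : ℕ → ℝ := fun j => (-1) ^ j / (j + 1)! with hc
  have hr : (FormalMultilinearSeries.ofScalars 𝔸 c).radius = ⊤ := by
    refine FormalMultilinearSeries.ofScalars_radius_eq_top_of_tendsto 𝔸 c
      (Eventually.of_forall fun n => by simp only [hc]; positivity) ?_
    have h : ∀ n : ℕ, ‖c n.succ‖ / ‖c n‖ = 1 / ((n + 1 : ℕ) + 1 : ℝ) := by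
      intro n
      have : ((n + 1)! : ℝ) ≠ 0 := by positivity
      simp only [hc, norm_div, norm_pow, norm_neg, norm_one, one_pow, Nat.factorial_succ (n + 1),
        Nat.succ_eq_add_one, RCLike.norm_natCast]
      push_cast
      field_simp
    simp_rw [h]
    exact (tendsto_add_atTop_iff_nat 1).2 tendsto_one_div_add_atTop_nhds_zero_nat
  have hs : HasFPowerSeriesOnBall (oneSubExpNegDiv : 𝔸 → 𝔸)
      (FormalMultilinearSeries.ofScalars 𝔸 c) 0 ⊤ := by
    have := (FormalMultilinearSeries.ofScalars 𝔸 c).hasFPowerSeriesOnBall (by simp [hr])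
    rw [hr] at this
    convert! this using 1
    exact (FormalMultilinearSeries.ofScalarsSum_eq_tsum c).symm
  refine contDiff_iff_contDiffAt.2 fun a => AnalyticAt.contDiffAt ?_
  exact hs.analyticAt_of_mem (by simp)

theorem hasDerivAt_smul_oneSubExpNegDiv_smul (a : 𝔸) :
    HasDerivAt (fun s : ℝ => s • oneSubExpNegDiv (s • a)) (1 - a * oneSubExpNegDiv a) 1 := by
  have hsum : ∀ x : 𝔸, Summable fun n : ℕ => ‖((n ! : ℝ)⁻¹) • x ^ n‖ :=
    fun x => NormedSpace.norm_expSeries_summable' x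
  have hfac : ∀ n : ℕ, ((n + 1)! : ℝ) = (n + 1) * n ! := fun n => by
    push_cast [Nat.factorial_succ]; ring
  have key := hasDerivAt_tsum_of_isPreconnected (𝕜 := ℝ) (F := 𝔸)
    (g := fun n s => (s ^ (n + 1) * ((-1) ^ n / (n + 1)!)) • a ^ n)
    (g' := fun n s => (((n + 1 : ℕ) * s ^ n) * ((-1) ^ n / (n + 1)!)) • a ^ n)
    (u := fun n => ‖((n ! : ℝ)⁻¹) • ((2 : ℝ) • a) ^ n‖) (t := Metric.ball 0 2) (y₀ := 0) (y := 1)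
    (hsum _) Metric.isOpen_ball (convex_ball _ _).isPreconnected
    (fun n s _ => by
      have := ((hasDerivAt_pow (n + 1) s).mul_const ((-1) ^ n / ((n + 1)! : ℝ))).smul_const (a ^ n)
      simpa using this)
    (fun n s hs => by
      have hs' : |s| ≤ 2 := by simpa using (Metric.mem_ball.1 hs).le
      rw [smul_pow, smul_smul, norm_smul, norm_smul]
      refine mul_le_mul_of_nonneg_right ?_ (norm_nonneg _)
      have : ((n + 1 : ℕ) * s ^ n) * ((-1) ^ n / ((n + 1)! : ℝ)) = (n ! : ℝ)⁻¹ * (s * -1) ^ n := by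
        have : (n ! : ℝ) ≠ 0 := by positivity
        rw [hfac, mul_pow]
        push_cast
        field_simp
      rw [this, norm_mul, norm_mul, norm_pow, norm_pow]
      gcongr
      simpa using hs')
    (by simp) (by simp) (by simp)
  convert! key using 1
  · funext s
    rw [oneSubExpNegDiv, ← tsum_const_smul'' s]
    refine tsum_congr fun n => ?_
    rw [smul_pow, smul_smul, smul_smul]
    congr 1
    ring
  · have hterm : ∀ n : ℕ, (((n + 1 : ℕ) * (1 : ℝ) ^ n) * ((-1) ^ n / (n + 1)!)) • a ^ n
        = ((n ! : ℝ)⁻¹) • (-a) ^ n := by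
      intro n
      have : (n ! : ℝ) ≠ 0 := by positivity
      rw [← neg_one_smul ℝ a, smul_pow, smul_smul, hfac]
      congr 1
      push_cast
      rw [one_pow]
      field_simp
    simp_rw [hterm]
    rw [(hsum (-a)).of_norm.tsum_eq_zero_add]
    have hs2 : Summable fun n : ℕ => ((-1 : ℝ) ^ n / (n + 1)!) • a ^ n := by
      refine .of_norm (.of_nonneg_of_le (fun _ => norm_nonneg _) (fun n => ?_) (hsum a))
      rw [norm_smul, norm_smul]
      refine mul_le_mul_of_nonneg_right ?_ (norm_nonneg _)
      simp only [norm_div, norm_pow, norm_neg, norm_one, one_pow, RCLike.norm_natCast, norm_inv,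
        one_div]
      have : n ! ≤ (n + 1)! := Nat.factorial_le n.le_succ
      gcongr
    rw [oneSubExpNegDiv, ← hs2.tsum_mul_left, sub_eq_add_neg, ← tsum_neg]
    simp only [Nat.factorial_zero, Nat.cast_one, inv_one, pow_zero, one_smul]
    congr 1
    refine tsum_congr fun n => ?_
    rw [mul_smul_comm, ← _root_.pow_succ', ← neg_smul, ← neg_one_smul ℝ a, smul_pow, smul_smul]
    congr 1
    rw [pow_succ]
    ring

theorem fderiv_oneSubExpNegDiv_apply_self (a : 𝔸) :
    fderiv ℝ oneSubExpNegDiv a a = 1 - a * oneSubExpNegDiv a - oneSubExpNegDiv a := by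
  have hd : HasFDerivAt (oneSubExpNegDiv : 𝔸 → 𝔸) (fderiv ℝ oneSubExpNegDiv a) ((1 : ℝ) • a) := by
    rw [one_smul]
    exact (contDiff_oneSubExpNegDiv (n := 1)).differentiable one_ne_zero a |>.hasFDerivAt
  have h1 := hd.comp_hasDerivAt (1 : ℝ) ((hasDerivAt_id (1 : ℝ)).smul_const a)
  have h2 := (hasDerivAt_id (1 : ℝ)).smul h1
  have := h2.unique (hasDerivAt_smul_oneSubExpNegDiv_smul a)
  simp only [id, one_smul, Function.comp] at this
  rw [← this]
  abel

end ExpQuotient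

section MaurerCartan

variable {V W : Type*} [NormedAddCommGroup V] [NormedSpace ℝ V] [NormedAddCommGroup W]
  [NormedSpace ℝ W]

theorem eq_zero_of_fderiv_apply_self_eq {G : V → W} (T : V →L[ℝ] W →L[ℝ] W)
    (hG : Differentiable ℝ G) (h : ∀ p, fderiv ℝ G p p = -(2 : ℝ) • G p - T p (G p)) (k : V) :
    G k = 0 := by
  have hf : ∀ s : ℝ, HasDerivAt (fun s : ℝ => s ^ 2 • G (s • k))
      ((-T k) (s ^ 2 • G (s • k))) s := by
    intro s
    have h1 := (hG (s • k)).hasFDerivAt.comp_hasDerivAt s ((hasDerivAt_id s).smul_const k)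
    convert! (hasDerivAt_pow 2 s).smul h1 using 1
    have h2 : s • fderiv ℝ G (s • k) k = -(2 : ℝ) • G (s • k) - s • T k (G (s • k)) := by
      simpa using h (s • k)
    simp only [one_smul, Function.comp, id, pow_two s, mul_smul, h2, map_smul, smul_sub,
      _root_.neg_apply, smul_neg, neg_smul]
    module
  have hz : ∀ s : ℝ, HasDerivAt (fun _ : ℝ => (0 : W)) ((-T k) 0) s := fun s => by
    simpa using hasDerivAt_const s (0 : W)
  have := ODE_solution_unique_univ (t₀ := 0) (s := fun _ => Set.univ) (v := fun _ => (-T k))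
    (fun _ => (-T k).lipschitz.lipschitzOnWith) (fun t => ⟨hf t, trivial⟩)
    (fun t => ⟨hz t, trivial⟩) (by simp)
  simpa using congrFun this 1

variable [CompleteSpace V]

/-- The Maurer–Cartan equation for the form `(1 - exp (-ad k)) / ad k` of a Lie bracket `L`. -/
theorem fderiv_oneSubExpNegDiv_maurerCartan (L : V →L[ℝ] V →L[ℝ] V)
    (hanti : ∀ u v, L u v = -L v u)
    (hjac : ∀ p u v, L p (L u v) = L (L p u) v + L u (L p v)) (k u v : V) :
    fderiv ℝ (fun k => oneSubExpNegDiv (L k)) k u v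
      - fderiv ℝ (fun k => oneSubExpNegDiv (L k)) k v u
      + L (oneSubExpNegDiv (L k) u) (oneSubExpNegDiv (L k) v) = 0 := by
  set Y : V → V →L[ℝ] V := fun k => oneSubExpNegDiv (L k) with hYdef
  have hY : ContDiff ℝ 2 Y := contDiff_oneSubExpNegDiv.comp L.contDiff
  have hY1 : Differentiable ℝ Y := hY.differentiable two_ne_zero
  have hY2 : Differentiable ℝ (fderiv ℝ Y) :=
    (hY.fderiv_right (m := 1) (by norm_num)).differentiable one_ne_zero
  have hEuler : ∀ p, fderiv ℝ Y p p = 1 - L p * Y p - Y p := by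
    intro p
    have hd := ((contDiff_oneSubExpNegDiv (𝔸 := V →L[ℝ] V) (n := 1)).differentiable one_ne_zero
      (L p)).hasFDerivAt.comp p L.hasFDerivAt
    have : fderiv ℝ Y p p = fderiv ℝ oneSubExpNegDiv (L p) (L p) := by
      have := hd.fderiv
      exact congrArg (fun T => T p) this
    rw [this, fderiv_oneSubExpNegDiv_apply_self]
  have hEuler' : ∀ p w, fderiv ℝ (fderiv ℝ Y) p p w
      = -(L w * Y p) - L p * fderiv ℝ Y p w - (2 : ℝ) • fderiv ℝ Y p w := by
    intro p w
    have h1 := (hY2 p).hasFDerivAt.clm_apply (hasFDerivAt_id p)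
    have h2 := ((L.hasFDerivAt (x := p)).mul' (hY1 p).hasFDerivAt).const_sub 1 |>.sub
      (hY1 p).hasFDerivAt
    have h3 := h1.unique (h2.congr_of_eventuallyEq (.of_forall hEuler))
    have h4 := congrArg (fun T => T w) h3
    have hsymm := (hY.contDiffAt (x := p)).isSymmSndFDerivAt (by simp) p w
    simp at h4
    rw [hsymm, two_smul]
    rw [← eq_sub_iff_add_eq'] at h4
    rw [h4]
    abel
  refine eq_zero_of_fderiv_apply_self_eq (G := fun k => fderiv ℝ Y k u v - fderiv ℝ Y k v u
      + L (Y k u) (Y k v)) L (by fun_prop) (fun p => ?_) k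
  have hd : ∀ a b, HasFDerivAt (fun k => fderiv ℝ Y k a b) _ p := fun a b =>
    ((hY2 p).hasFDerivAt.clm_apply (hasFDerivAt_const a p)).clm_apply (hasFDerivAt_const b p)
  have hYa : ∀ a, HasFDerivAt (fun k => Y k a) _ p := fun a =>
    (hY1 p).hasFDerivAt.clm_apply (hasFDerivAt_const a p)
  have hL := (L.hasFDerivAt.comp p (hYa u)).clm_apply (hYa v)
  have := (((hd u v).sub (hd v u)).add hL).fderiv
  have h4 := congrArg (fun T => T p) this
  simp [hEuler, hEuler'] at h4
  refine h4.trans ?_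
  simp [hjac p, hanti (Y p u) v]
  module

end MaurerCartan

section BracketOfDualFields

variable {V : Type*} [NormedAddCommGroup V] [NormedSpace ℝ V] [CompleteSpace V]

theorem fderiv_ringInverse_comp_apply {Y : V → V →L[ℝ] V} {k : V} (hY : DifferentiableAt ℝ Y k)
    (hk : IsUnit (Y k)) (b w : V) :
    DifferentiableAt ℝ (fun p => Ring.inverse (Y p) b) k ∧
    fderiv ℝ (fun p => Ring.inverse (Y p) b) k w
      = -Ring.inverse (Y k) (fderiv ℝ Y k w (Ring.inverse (Y k) b)) := by
  obtain ⟨x, hx⟩ := hk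
  have h1 := hasFDerivAt_ringInverse (𝕜 := ℝ) x
  rw [hx] at h1
  have h2 := (h1.comp k hY.hasFDerivAt).clm_apply (hasFDerivAt_const b k)
  refine ⟨h2.differentiableAt, ?_⟩
  have h3 := congrArg (fun T => T w) h2.fderiv
  refine h3.trans ?_
  simp [← hx]

end BracketOfDualFields

section StructureConstants

variable {n : Type*} [Fintype n] [DecidableEq n]

/-- Square matrices as continuous endomorphisms of `n → ℝ`. -/
noncomputable def Matrix.toCLMAlgEquiv : Matrix n n ℝ ≃ₐ[ℝ] ((n → ℝ) →L[ℝ] (n → ℝ)) :=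
  Matrix.toLinAlgEquiv'.trans (Module.End.toContinuousLinearMap (n → ℝ))

@[simp]
theorem Matrix.toCLMAlgEquiv_apply (M : Matrix n n ℝ) (v : n → ℝ) :
    Matrix.toCLMAlgEquiv M v = M *ᵥ v := rfl

theorem Matrix.toCLMAlgEquiv_inv (M : Matrix n n ℝ) :
    Matrix.toCLMAlgEquiv M⁻¹ = Ring.inverse (Matrix.toCLMAlgEquiv M) := by
  rw [Matrix.nonsing_inv_eq_ringInverse]
  by_cases h : IsUnit M
  · obtain ⟨x, rfl⟩ := h
    have := Ring.inverse_unit (Units.map (Matrix.toCLMAlgEquiv (n := n)).toMulEquiv.toMonoidHom x)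
    simpa using this.symm
  · rw [Ring.inverse_non_unit _ h, Ring.inverse_non_unit, map_zero]
    simpa using h

theorem Matrix.toCLMAlgEquiv_tsum {ι : Type*} (f : ι → Matrix n n ℝ) :
    Matrix.toCLMAlgEquiv (∑' i, f i) = ∑' i, Matrix.toCLMAlgEquiv (f i) :=
  (Matrix.toCLMAlgEquiv (n := n)).toLinearEquiv.toContinuousLinearEquiv.map_tsum

/-- The adjoint representation `k ↦ ∑ A, k A • CM A` as a continuous bilinear map. -/
noncomputable def adjointCLM (CM : n → Matrix n n ℝ) :
    (n → ℝ) →L[ℝ] (n → ℝ) →L[ℝ] (n → ℝ) :=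
  LinearMap.toContinuousLinearMap
    (Matrix.toCLMAlgEquiv.toLinearMap ∘ₗ Fintype.linearCombination ℝ CM)

theorem adjointCLM_apply (CM : n → Matrix n n ℝ) (k : n → ℝ) :
    adjointCLM CM k = Matrix.toCLMAlgEquiv (∑ A, k A • CM A) := rfl

variable {C : n → n → n → ℝ} {CM : n → Matrix n n ℝ}

theorem adjointCLM_apply_apply (hCM : ∀ A B C', CM A B C' = C B A C')
    (u v : n → ℝ) (i : n) :
    adjointCLM CM u v i = ∑ A, ∑ B, u A * v B * C i A B := by
  simp only [adjointCLM_apply, Matrix.toCLMAlgEquiv_apply, Matrix.mulVec, dotProduct,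
    Matrix.sum_apply, Matrix.smul_apply, hCM, smul_eq_mul, Finset.sum_mul]
  rw [Finset.sum_comm]
  exact Finset.sum_congr rfl fun _ _ => Finset.sum_congr rfl fun _ _ => by ring

theorem adjointCLM_antisymm (hCM : ∀ A B C', CM A B C' = C B A C')
    (hCanti : ∀ A B C', C A B C' = -C A C' B) (u v : n → ℝ) :
    adjointCLM CM u v = -adjointCLM CM v u := by
  ext i
  rw [Pi.neg_apply, adjointCLM_apply_apply hCM, adjointCLM_apply_apply hCM, Finset.sum_comm,
    ← Finset.sum_neg_distrib]
  refine Finset.sum_congr rfl fun A _ => ?_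
  rw [← Finset.sum_neg_distrib]
  refine Finset.sum_congr rfl fun B _ => ?_
  rw [hCanti i B A]
  ring

theorem adjointCLM_jacobi (hCM : ∀ A B C', CM A B C' = C B A C')
    (hCC : ∀ A B, CM A * CM B - CM B * CM A = ∑ C', C C' A B • CM C')
    (p u v : n → ℝ) :
    adjointCLM CM p (adjointCLM CM u v)
      = adjointCLM CM (adjointCLM CM p u) v + adjointCLM CM u (adjointCLM CM p v) := by
  have h : (∑ A, p A • CM A) * (∑ A, u A • CM A) - (∑ A, u A • CM A) * (∑ A, p A • CM A)
      = ∑ i, adjointCLM CM p u i • CM i := by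
    simp only [adjointCLM_apply_apply hCM, Finset.sum_smul, Finset.sum_mul_sum]
    rw [Finset.sum_comm (f := fun i j => u i • CM i * p j • CM j), ← Finset.sum_sub_distrib,
      Finset.sum_comm]
    refine Finset.sum_congr rfl fun A _ => ?_
    rw [← Finset.sum_sub_distrib, Finset.sum_comm]
    refine Finset.sum_congr rfl fun B _ => ?_
    simp only [mul_smul, ← Finset.smul_sum, ← hCC, smul_mul_assoc, mul_smul_comm, smul_sub]
    rw [smul_comm (u B)]
  have h2 := congrArg (fun M => Matrix.toCLMAlgEquiv M v) h
  simp only [map_sub, map_mul, ← adjointCLM_apply] at h2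
  rw [← h2]
  simp

end StructureConstants

/-- The right-invariant vector fields `X_A = X_A{}^M ∂_M`, where the entries
`X_A{}^M(k)` are determined by `Y^B_M X_A{}^M = δ^B_A` (i.e. `X(k) = Y(k)⁻¹`, transposed),
form a representation of the Lie algebra: `[X_A, X_B] = C^C_{AB} X_C` on
`U = {k : Y(k) invertible}`. -/
theorem right_invariant_fields_commutation
    (N : ℕ)
    (C : Fin N → Fin N → Fin N → ℝ)
    (hCanti : ∀ A B C', C A B C' = -C A C' B)
    (CM : Fin N → Matrix (Fin N) (Fin N) ℝ)
    (hCM : ∀ A B C', CM A B C' = C B A C')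
    (hCC : ∀ A B, CM A * CM B - CM B * CM A = ∑ C', C C' A B • CM C')
    (Y : (Fin N → ℝ) → Matrix (Fin N) (Fin N) ℝ)
    (hY : ∀ k, Y k =
      ∑' j : ℕ, ((-1 : ℝ) ^ j / (Nat.factorial (j + 1))) • (∑ A, k A • CM A) ^ j)
    (U : Set (Fin N → ℝ))
    (hU : U = {k | IsUnit (Y k)})
    (X : (Fin N → ℝ) → Fin N → Fin N → ℝ)
    (hX : ∀ k A M, X k A M = (Y k)⁻¹ M A) :
    ∀ k ∈ U, ∀ A B N',
      ∑ M, (X k A M * partialDeriv' (fun k' => X k' B N') M k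
            - X k B M * partialDeriv' (fun k' => X k' A N') M k)
        = ∑ C', C C' A B * X k C' N' := by
  subst hU
  intro k hk A B N'
  set L := adjointCLM CM
  set Yc : (Fin N → ℝ) → (Fin N → ℝ) →L[ℝ] (Fin N → ℝ) := fun p => oneSubExpNegDiv (L p)
    with hYc
  have hYY : ∀ p, Matrix.toCLMAlgEquiv (Y p) = Yc p := fun p => by
    simp only [hY, Matrix.toCLMAlgEquiv_tsum, map_smul, map_pow, hYc, oneSubExpNegDiv]
    rfl
  have hunit : IsUnit (Yc k) := by
    rw [← hYY]
    exact hk.map _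
  have hXc : ∀ p D M, X p D M = Ring.inverse (Yc p) (Pi.single D 1) M := fun p D M => by
    rw [hX, ← hYY, ← Matrix.toCLMAlgEquiv_inv, Matrix.toCLMAlgEquiv_apply,
      Matrix.mulVec_single_one, Matrix.col_apply]
  have hYd : DifferentiableAt ℝ Yc k :=
    ((contDiff_oneSubExpNegDiv (n := 1)).comp L.contDiff).differentiable one_ne_zero k
  have hdir : ∀ D E, ∑ M, X k D M * partialDeriv' (fun p => X p E N') M k
      = -Ring.inverse (Yc k) (fderiv ℝ Yc k (Ring.inverse (Yc k) (Pi.single D 1))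
          (Ring.inverse (Yc k) (Pi.single E 1))) N' := by
    intro D E
    have hd := (hasFDerivAt_pi'.1
      (fderiv_ringInverse_comp_apply hYd hunit (Pi.single E 1) 0).1.hasFDerivAt N').fderiv
    simp only [partialDeriv', hXc, hd, ← smul_eq_mul, ← map_smul]
    rw [← map_sum, ← pi_eq_sum_univ']
    simp [(fderiv_ringInverse_comp_apply hYd hunit _ _).2]
  have hinv : ∀ w, Yc k (Ring.inverse (Yc k) w) = w := fun w => by
    rw [← mul_apply_eq_comp, Ring.mul_inverse_cancel _ hunit]
    rfl
  have hMC := fderiv_oneSubExpNegDiv_maurerCartan L (adjointCLM_antisymm hCM hCanti)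
    (adjointCLM_jacobi hCM hCC) k (Ring.inverse (Yc k) (Pi.single A 1))
    (Ring.inverse (Yc k) (Pi.single B 1))
  rw [hinv, hinv, add_eq_zero_iff_eq_neg, ← neg_eq_iff_eq_neg] at hMC
  rw [Finset.sum_sub_distrib, hdir, hdir]
  have hlin : ∑ C', C C' A B * X k C' N'
      = Ring.inverse (Yc k) (L (Pi.single A 1) (Pi.single B 1)) N' := by
    rw [pi_eq_sum_univ' (L (Pi.single A 1) (Pi.single B 1)), map_sum, Finset.sum_apply]
    refine Finset.sum_congr rfl fun C' _ => ?_
    rw [map_smul, hXc, adjointCLM_apply_apply hCM]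
    simp [Pi.single_apply]
  rw [hlin, ← hMC, map_neg, map_sub, Pi.neg_apply, Pi.sub_apply]
  ring
end

section
/- Let N ∈ ℕ and let C^A_{BC} (A,B,C = 1,…,N) be real constants, antisymmetric in the lower indices (C^A_{BC} = −C^A_{CB}), such that the N×N matrices C_A with entries (C_A)^B_C = C^B_{AC} satisfy [C_A, C_B] = Σ_C C^C_{AB} C_C. For k ∈ ℝ^N set C(k) := Σ_A k^A C_A and Y(k) := Σ_{j≥0} (−1)^j C(k)^j/(j+1)!. Then: (i) C(k)·k = 0 and hence Y(k)·k = k for every k ∈ ℝ^N; (ii) on the open set U := {k : Y(k) invertible}, Y(k)^{−1}·k = k; and (iii) writing X^A_M(k) for the entries of X(k) := Y(k)^{−1}, for every k ∈ U: Σ_{A,M} k^M · ∂X^A_M/∂k^A (k) = N − tr X(k). -/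
open Matrix

open Filter Topology FormalMultilinearSeries in
/-- The power series `∑ (-1)^j x^j / (j+1)!` converges everywhere. -/
theorem ofScalars_neg_one_pow_div_factorial_succ_radius
    (E : Type*) [NormedRing E] [NormedAlgebra ℝ E] :
    (ofScalars E fun j : ℕ => (-1 : ℝ) ^ j / (Nat.factorial (j + 1))).radius = ⊤ := by
  refine ofScalars_radius_eq_top_of_tendsto E _ (.of_forall fun n => by positivity) ?_
  have h : Tendsto (fun n : ℕ => 1 / (((n + 1 : ℕ) : ℝ) + 1)) atTop (𝓝 0) :=
    (tendsto_add_atTop_iff_nat 1).2 tendsto_one_div_add_atTop_nhds_zero_nat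
  refine h.congr fun n => ?_
  have h1 : (Nat.factorial (n + 1) : ℝ) ≠ 0 := by positivity
  simp only [norm_div, norm_pow, norm_neg, norm_one, one_pow, Real.norm_natCast,
    Nat.factorial_succ (n + 1), Nat.succ_eq_add_one]
  push_cast
  field_simp

section NormedAlgebra

variable {E : Type*} [NormedRing E] [NormedAlgebra ℝ E] [CompleteSpace E]

open FormalMultilinearSeries in
theorem summable_neg_one_pow_div_factorial_succ_smul_pow (x : E) :
    Summable fun j : ℕ => ((-1 : ℝ) ^ j / (Nat.factorial (j + 1))) • x ^ j := by
  rw [← ofScalars_apply_eq']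
  exact FormalMultilinearSeries.summable _
    (by simp [ofScalars_neg_one_pow_div_factorial_succ_radius])

open FormalMultilinearSeries in
theorem differentiable_tsum_neg_one_pow_div_factorial_succ_smul_pow :
    Differentiable ℝ fun x : E =>
      ∑' j : ℕ, ((-1 : ℝ) ^ j / (Nat.factorial (j + 1))) • x ^ j := by
  intro x
  rw [← ofScalarsSum_eq_tsum]
  exact (FormalMultilinearSeries.hasFDerivAt_sum
    (by simp [ofScalars_neg_one_pow_div_factorial_succ_radius])).differentiableAt

end NormedAlgebra

open scoped Matrix.Norms.Operator in
theorem Matrix.tsum_neg_one_pow_div_factorial_succ_mulVec {n : Type*} [Fintype n] [DecidableEq n]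
    {A : Matrix n n ℝ} {v : n → ℝ} (h : A *ᵥ v = 0) :
    (∑' j : ℕ, ((-1 : ℝ) ^ j / (Nat.factorial (j + 1))) • A ^ j) *ᵥ v = v := by
  have hs := (summable_neg_one_pow_div_factorial_succ_smul_pow A).hasSum.map
    (AddMonoidHom.mk' (fun B : Matrix n n ℝ => B *ᵥ v) fun B B' => add_mulVec B B' v)
    (continuous_id.matrix_mulVec continuous_const)
  refine hs.unique ?_
  convert hasSum_single (f := _) 0 fun j hj => ?_ using 1
  · simp
  · obtain ⟨i, rfl⟩ := Nat.exists_eq_succ_of_ne_zero hj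
    simp [pow_succ, smul_mulVec, ← mulVec_mulVec, h]

open scoped Matrix.Norms.Operator in
theorem Matrix.differentiableAt_inv_apply {n V : Type*} [Fintype n] [DecidableEq n]
    [NormedAddCommGroup V] [NormedSpace ℝ V] {Y : V → Matrix n n ℝ} {k : V}
    (hY : DifferentiableAt ℝ Y k) (hk : IsUnit (Y k)) (i j : n) :
    DifferentiableAt ℝ (fun k' => (Y k')⁻¹ i j) k := by
  have h : DifferentiableAt ℝ (fun k' => (Y k')⁻¹) k := by
    simp only [nonsing_inv_eq_ringInverse]
    exact (differentiableAt_inverse hk).comp k hY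
  exact (LinearMap.toContinuousLinearMap (entryLinearMap ℝ ℝ i j)).differentiableAt.comp k h

open Topology in
/-- The divergence-type identity for a differentiable matrix field `X` fixing its argument. -/
theorem sum_mul_partialDeriv_eq_of_mulVec_self {N : ℕ}
    {X : (Fin N → ℝ) → Matrix (Fin N) (Fin N) ℝ} {k : Fin N → ℝ}
    (hX : ∀ A M, DifferentiableAt ℝ (fun k' => X k' A M) k)
    (hfix : ∀ᶠ k' in 𝓝 k, X k' *ᵥ k' = k') :
    ∑ A, ∑ M, k M * partialDeriv' (fun k' => X k' A M) A k = (N : ℝ) - (X k).trace := by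
  have key (A : Fin N) :
      ∑ M, k M * partialDeriv' (fun k' => X k' A M) A k = 1 - X k A A := by
    have hproj (M : Fin N) : HasFDerivAt (fun k' : Fin N → ℝ => k' M)
        (ContinuousLinearMap.proj (R := ℝ) (φ := fun _ : Fin N => ℝ) M) k :=
      (ContinuousLinearMap.proj (R := ℝ) (φ := fun _ : Fin N => ℝ) M).hasFDerivAt
    have hsum := HasFDerivAt.fun_sum (u := Finset.univ) fun M _ =>
      (hX A M).hasFDerivAt.mul (hproj M)
    have heq : (fun k' : Fin N → ℝ => ∑ M, X k' A M * k' M) =ᶠ[𝓝 k] fun k' => k' A :=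
      hfix.mono fun k' hk' => congrFun hk' A
    have h := congrArg (fun L => L (Pi.single A 1))
      (hsum.unique ((hproj A).congr_of_eventuallyEq heq))
    simp [Finset.sum_add_distrib, Pi.single_apply] at h
    simp only [partialDeriv']
    linarith
  simp [key, Matrix.trace]

/-- (i) `C(k)k = 0` and `Y(k)k = k`; (ii) `Y(k)⁻¹k = k` on
`U = {k : Y(k) invertible}`; (iii) `k^M ∂_A X^A_M = N − tr X` on `U`, where `X = Y⁻¹`. -/
theorem Y_fixes_k_and_divergence_identity
    (N : ℕ)
    (C : Fin N → Fin N → Fin N → ℝ)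
    (hCanti : ∀ A B C', C A B C' = -C A C' B)
    (CM : Fin N → Matrix (Fin N) (Fin N) ℝ)
    (hCM : ∀ A B C', CM A B C' = C B A C')
    (hCC : ∀ A B, CM A * CM B - CM B * CM A = ∑ C', C C' A B • CM C')
    (Ck : (Fin N → ℝ) → Matrix (Fin N) (Fin N) ℝ)
    (hCk : ∀ k, Ck k = ∑ A, k A • CM A)
    (Y : (Fin N → ℝ) → Matrix (Fin N) (Fin N) ℝ)
    (hY : ∀ k, Y k =
      ∑' j : ℕ, ((-1 : ℝ) ^ j / (Nat.factorial (j + 1))) • (Ck k) ^ j)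
    (U : Set (Fin N → ℝ))
    (hU : U = {k | IsUnit (Y k)}) :
    (∀ k, (Ck k).mulVec k = 0 ∧ (Y k).mulVec k = k) ∧
    (∀ k ∈ U, ((Y k)⁻¹).mulVec k = k) ∧
    (∀ k ∈ U,
      ∑ A, ∑ M, k M * partialDeriv' (fun k' => (Y k')⁻¹ A M) A k
        = (N : ℝ) - ((Y k)⁻¹).trace) := by
  have hmul (k) : Ck k *ᵥ k = 0 := by
    ext B
    have h : (Ck k *ᵥ k) B = ∑ M, ∑ A, k A * C B A M * k M := by
      simp [hCk, mulVec, dotProduct, Matrix.sum_apply, hCM, Finset.sum_mul]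
    have h' : (Ck k *ᵥ k) B = -∑ M, ∑ A, k A * C B A M * k M := by
      rw [h, ← Finset.sum_neg_distrib]
      conv_lhs => rw [Finset.sum_comm]
      refine Finset.sum_congr rfl fun M _ => ?_
      rw [← Finset.sum_neg_distrib]
      refine Finset.sum_congr rfl fun A _ => ?_
      rw [hCanti B M A]
      ring
    simp only [Pi.zero_apply]
    linarith
  have hfix (k) : Y k *ᵥ k = k := by
    rw [hY]
    exact tsum_neg_one_pow_div_factorial_succ_mulVec (hmul k)
  have hinv (k) (hk : IsUnit (Y k)) : (Y k)⁻¹ *ᵥ k = k := by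
    have h := congrArg ((Y k)⁻¹ *ᵥ ·) (hfix k)
    simpa [mulVec_mulVec, nonsing_inv_mul _ ((isUnit_iff_isUnit_det _).1 hk)] using h.symm
  subst hU
  refine ⟨fun k => ⟨hmul k, hfix k⟩, hinv, fun k hk => ?_⟩
  open scoped Matrix.Norms.Operator in
  have hCd : Differentiable ℝ Ck := by
    rw [funext hCk]
    fun_prop
  open scoped Matrix.Norms.Operator in
  have hYd : Differentiable ℝ Y := by
    rw [funext hY]
    exact differentiable_tsum_neg_one_pow_div_factorial_succ_smul_pow.comp hCd
  have hU : ∀ᶠ k' in nhds k, IsUnit (Y k') := by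
    open scoped Matrix.Norms.Operator in
    exact hYd.continuous.continuousAt.eventually (Units.isOpen.mem_nhds hk)
  exact sum_mul_partialDeriv_eq_of_mulVec_self
    (differentiableAt_inv_apply (hYd k) hk) (hU.mono hinv)
end

section
/- Let N ∈ ℕ and let C^A_{BC} (A,B,C = 1,…,N) be real constants, antisymmetric in the lower indices, such that the N×N matrices C_A with entries (C_A)^B_C = C^B_{AC} satisfy [C_A, C_B] = Σ_C C^C_{AB} C_C. Let γ = (γ_{AB}) be a real symmetric invertible N×N matrix satisfying γ_{AB} C^B_{CD} + γ_{DB} C^B_{CA} = 0. For k ∈ ℝ^N set C(k) := Σ_A k^A C_A, Y(k) := Σ_{j≥0} (−1)^j C(k)^j/(j+1)!, and on the open set U := {k : Y(k) invertible} define X_A{}^M(k) by Σ_M Y^B_M(k) X_A{}^M(k) = δ^B_A. Then the vector fields X_A are divergence-free with respect to the density det Y: for every A and every k ∈ U, Σ_M ∂/∂k^M [ det Y(k) · X_A{}^M(k) ] = 0. -/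
open Matrix

open Finset in
/-- The directional derivative of `A ↦ A ^ n` at `K` in the direction `W`. -/
def powDeriv {R : Type*} [Ring R] (K W : R) (n : ℕ) : R :=
  ∑ i ∈ range n, K ^ (n.pred - i) * W * K ^ i

lemma powDeriv_zero {R : Type*} [Ring R] (K W : R) : powDeriv K W 0 = 0 := by
  simp [powDeriv]

lemma powDeriv_succ {R : Type*} [Ring R] (K W : R) (n : ℕ) :
    powDeriv K W (n + 1) = K * powDeriv K W n + W * K ^ n := by
  unfold powDeriv
  rw [Finset.sum_range_succ, Finset.mul_sum]
  congr 1
  · refine Finset.sum_congr rfl fun i hi => ?_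
    have hi' := Finset.mem_range.1 hi
    have : (n + 1).pred - i = (n.pred - i) + 1 := by
      simp only [Nat.pred_eq_sub_one]; omega
    rw [this, pow_succ']
    simp only [mul_assoc]
  · simp

/-- The Taylor coefficients of `(1 - exp (-x)) / x`. -/
noncomputable def dexpCoeff (n : ℕ) : ℝ := (-1 : ℝ) ^ n / (Nat.factorial (n + 1))

lemma dexpCoeff_zero : dexpCoeff 0 = 1 := by simp [dexpCoeff]

lemma succ_mul_dexpCoeff_succ (n : ℕ) :
    ((n : ℝ) + 2) * dexpCoeff (n + 1) = -dexpCoeff n := by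
  unfold dexpCoeff
  rw [Nat.factorial_succ (n + 1), pow_succ]
  have h1 : ((n + 1).factorial : ℝ) ≠ 0 := by exact_mod_cast Nat.factorial_ne_zero _
  have h2 : (n : ℝ) + 2 ≠ 0 := by positivity
  have h3 : (n : ℝ) + 1 + 1 ≠ 0 := by positivity
  push_cast
  field_simp
  ring

lemma abs_dexpCoeff (n : ℕ) : |dexpCoeff n| = 1 / (Nat.factorial (n + 1)) := by
  simp [dexpCoeff, abs_div]

lemma abs_dexpCoeff_mul_le (n : ℕ) : |dexpCoeff n| * n ≤ 1 / (Nat.factorial n) := by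
  rw [abs_dexpCoeff, Nat.factorial_succ]
  have h1 : (0 : ℝ) < (n.factorial : ℝ) := by exact_mod_cast Nat.factorial_pos _
  push_cast
  rw [div_mul_eq_mul_div, div_le_div_iff₀ (by positivity) h1]
  nlinarith

lemma abs_dexpCoeff_le (n : ℕ) : |dexpCoeff n| ≤ 1 / (Nat.factorial n) := by
  rw [abs_dexpCoeff]
  have h1 : (0 : ℝ) < (n.factorial : ℝ) := by exact_mod_cast Nat.factorial_pos _
  exact one_div_le_one_div_of_le h1 (by exact_mod_cast Nat.factorial_le (Nat.le_succ n))

lemma hasSum_map_mul_antidiagonal {𝔸 : Type*} [NormedRing 𝔸] [NormedAlgebra ℝ 𝔸]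
    [CompleteSpace 𝔸] {f : ℕ → 𝔸} (hf : Summable fun n => ‖f n‖)
    (g : 𝔸 →L[ℝ] 𝔸) : HasSum (fun n => ∑ p ∈ Finset.HasAntidiagonal.antidiagonal n,
      g (f p.1) * f p.2) (g (∑' n, f n) * ∑' n, f n) := by
  have hg : Summable fun n => ‖g (f n)‖ :=
    Summable.of_nonneg_of_le (fun _ => norm_nonneg _) (fun n => g.le_opNorm _) (hf.mul_left ‖g‖)
  rw [g.map_tsum hf.of_norm, tsum_mul_tsum_eq_tsum_sum_antidiagonal_of_summable_norm hg hf]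
  exact (summable_norm_sum_mul_antidiagonal_of_summable_norm hg hf).of_norm.hasSum

section NormedAlgebra

variable {𝔸 : Type*} [NormedRing 𝔸] [NormedAlgebra ℝ 𝔸] [NormOneClass 𝔸]

lemma summable_norm_dexpSeries (K : 𝔸) : Summable fun j => ‖dexpCoeff j • K ^ j‖ := by
  refine Summable.of_nonneg_of_le (fun _ => norm_nonneg _) (fun j => ?_)
    (Real.summable_pow_div_factorial ‖K‖)
  rw [norm_smul, Real.norm_eq_abs]
  calc |dexpCoeff j| * ‖K ^ j‖ ≤ (1 / (Nat.factorial j)) * ‖K‖ ^ j := by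
        gcongr
        · exact abs_dexpCoeff_le j
        · exact norm_pow_le K j
    _ = _ := by ring

lemma norm_dexpCoeff_smul_powDeriv_le {K : 𝔸} {R : ℝ} (hR : 1 ≤ R) (hK : ‖K‖ ≤ R) (W : 𝔸)
    (n : ℕ) : ‖dexpCoeff n • powDeriv K W n‖ ≤ (R ^ n / (Nat.factorial n)) * ‖W‖ := by
  have hR0 : 0 ≤ R := zero_le_one.trans hR
  have key : ‖powDeriv K W n‖ ≤ n * (R ^ n * ‖W‖) := by
    unfold powDeriv
    refine (norm_sum_le _ _).trans ?_
    refine (Finset.sum_le_card_nsmul _ _ (R ^ n * ‖W‖) fun i hi => ?_).trans (by simp)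
    have hi' := Finset.mem_range.1 hi
    have hp : ∀ m, ‖K ^ m‖ ≤ R ^ m := fun m =>
      (norm_pow_le K m).trans (pow_le_pow_left₀ (norm_nonneg _) hK m)
    calc ‖K ^ (n.pred - i) * W * K ^ i‖ ≤ ‖K ^ (n.pred - i)‖ * ‖W‖ * ‖K ^ i‖ :=
          norm_mul₃_le
      _ ≤ R ^ (n.pred - i) * ‖W‖ * R ^ i := by
          gcongr
          · exact hp _
          · exact hp _
      _ = R ^ (n.pred - i + i) * ‖W‖ := by rw [pow_add]; ring
      _ ≤ R ^ n * ‖W‖ := by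
          gcongr
          · simp only [Nat.pred_eq_sub_one]; omega
  rw [norm_smul, Real.norm_eq_abs]
  calc |dexpCoeff n| * ‖powDeriv K W n‖ ≤ |dexpCoeff n| * (n * (R ^ n * ‖W‖)) := by gcongr
    _ = (|dexpCoeff n| * n) * (R ^ n * ‖W‖) := by ring
    _ ≤ (1 / (Nat.factorial n)) * (R ^ n * ‖W‖) := by
        gcongr
        exact abs_dexpCoeff_mul_le n
    _ = _ := by ring

open scoped RightActions in
/-- Term-by-term differentiation of the series of `(1 - exp (-A)) / A`. -/
lemma exists_hasFDerivAt_dexpSeries [CompleteSpace 𝔸] (K : 𝔸) :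
    ∃ L : 𝔸 →L[ℝ] 𝔸, HasFDerivAt (fun A : 𝔸 => ∑' j, dexpCoeff j • A ^ j) L K ∧
      ∀ W, HasSum (fun j => dexpCoeff j • powDeriv K W j) (L W) := by
  set R : ℝ := ‖K‖ + 1 with hRdef
  have hR : 1 ≤ R := by simp [hRdef]
  have hu := Real.summable_pow_div_factorial R
  let D : ℕ → 𝔸 → 𝔸 →L[ℝ] 𝔸 := fun n A =>
    dexpCoeff n • ∑ i ∈ Finset.range n,
      A ^ (n.pred - i) •> ContinuousLinearMap.id ℝ 𝔸 <• A ^ i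
  have hD : ∀ n A W, D n A W = dexpCoeff n • powDeriv A W n := by
    intro n A W
    simp [D, powDeriv, mul_assoc]
  have hbound : ∀ n A, A ∈ Metric.ball (0 : 𝔸) R → ‖D n A‖ ≤ R ^ n / (Nat.factorial n) := by
    intro n A hA
    refine ContinuousLinearMap.opNorm_le_bound _ (by positivity) fun W => ?_
    rw [hD]
    exact norm_dexpCoeff_smul_powDeriv_le hR (mem_ball_zero_iff.1 hA).le W n
  have hK : K ∈ Metric.ball (0 : 𝔸) R := by simp [hRdef]
  refine ⟨∑' n, D n K, ?_, fun W => ?_⟩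
  · exact hasFDerivAt_tsum_of_isPreconnected hu Metric.isOpen_ball
      (convex_ball (0 : 𝔸) R).isPreconnected
      (fun n A _ => (hasFDerivAt_pow' (𝕜 := ℝ) n).const_smul (dexpCoeff n)) hbound hK
      (summable_norm_dexpSeries K).of_norm hK
  · have hs : Summable fun n => D n K := Summable.of_norm_bounded hu fun n => hbound n K hK
    have := (ContinuousLinearMap.apply ℝ 𝔸 W).hasSum hs.hasSum
    simpa [hD] using this

end NormedAlgebra

section AdjointRepresentation

variable {N : ℕ} (c : (Fin N → ℝ) →ₗ[ℝ] Matrix (Fin N) (Fin N) ℝ)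

/-- The degree-`n` part of the bracket `[Y v, Y w]`, where `[x, y] = c x *ᵥ y`. -/
noncomputable def bracketCoeff (k v w : Fin N → ℝ) (n : ℕ) : Fin N → ℝ :=
  ∑ p ∈ Finset.HasAntidiagonal.antidiagonal n,
    (dexpCoeff p.1 * dexpCoeff p.2) • (c ((c k) ^ p.1 *ᵥ v) *ᵥ ((c k) ^ p.2 *ᵥ w))

variable {c}

lemma mulVec_bracket (hrep : ∀ x y, c (c x *ᵥ y) = c x * c y - c y * c x) (k x y : Fin N → ℝ) :
    c k *ᵥ (c x *ᵥ y) = c (c k *ᵥ x) *ᵥ y + c x *ᵥ (c k *ᵥ y) := by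
  rw [hrep, Matrix.sub_mulVec, Matrix.mulVec_mulVec, Matrix.mulVec_mulVec]
  abel

lemma bracketCoeff_succ (hrep : ∀ x y, c (c x *ᵥ y) = c x * c y - c y * c x)
    (k v w : Fin N → ℝ) (n : ℕ) :
    ((n : ℝ) + 3) • bracketCoeff c k v w (n + 1) =
      dexpCoeff (n + 1) • (c v *ᵥ ((c k) ^ (n + 1) *ᵥ w) + c ((c k) ^ (n + 1) *ᵥ v) *ᵥ w)
        - c k *ᵥ bracketCoeff c k v w n := by
  set T : ℕ → ℕ → Fin N → ℝ := fun p q => c ((c k) ^ p *ᵥ v) *ᵥ ((c k) ^ q *ᵥ w) with hT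
  have hsplit : ((n : ℝ) + 3) • bracketCoeff c k v w (n + 1) =
      (∑ p ∈ Finset.HasAntidiagonal.antidiagonal (n + 1),
        (((p.1 : ℝ) + 1) * dexpCoeff p.1 * dexpCoeff p.2) • T p.1 p.2) +
      ∑ p ∈ Finset.HasAntidiagonal.antidiagonal (n + 1),
        (((p.2 : ℝ) + 1) * dexpCoeff p.2 * dexpCoeff p.1) • T p.1 p.2 := by
    unfold bracketCoeff
    rw [Finset.smul_sum, ← Finset.sum_add_distrib]
    refine Finset.sum_congr rfl fun p hp => ?_
    have hp' : (p.1 : ℝ) + p.2 = n + 1 := by exact_mod_cast Finset.HasAntidiagonal.mem_antidiagonal.1 hp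
    have hn : (n : ℝ) + 3 = (p.1 + 1) + (p.2 + 1) := by linarith
    rw [smul_smul, ← add_smul, hn]
    congr 1
    ring
  have hstep : ∀ m : ℕ, (((m + 1 : ℕ) : ℝ) + 1) * dexpCoeff (m + 1) = -dexpCoeff m := by
    intro m
    rw [← succ_mul_dexpCoeff_succ]
    push_cast
    ring
  have hbr : c k *ᵥ bracketCoeff c k v w n = ∑ p ∈ Finset.HasAntidiagonal.antidiagonal n,
      (dexpCoeff p.1 * dexpCoeff p.2) • (T (p.1 + 1) p.2 + T p.1 (p.2 + 1)) := by
    unfold bracketCoeff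
    rw [Matrix.mulVec_sum]
    refine Finset.sum_congr rfl fun p _ => ?_
    rw [Matrix.mulVec_smul, mulVec_bracket hrep]
    simp only [hT, Matrix.mulVec_mulVec, ← pow_succ']
  rw [hsplit, Finset.Nat.sum_antidiagonal_succ, Finset.Nat.sum_antidiagonal_succ', hbr]
  simp only [hstep, dexpCoeff_zero, hT, pow_zero, Matrix.one_mulVec, Nat.cast_zero, zero_add,
    one_mul, neg_mul, neg_smul, Finset.sum_neg_distrib, smul_add, Finset.sum_add_distrib]
  simp only [mul_comm (dexpCoeff _) (dexpCoeff _)]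
  abel

/-- The Maurer–Cartan equation, degree by degree. -/
lemma dexpCoeff_smul_powDeriv_sub (hanti : ∀ x y, c x *ᵥ y = -(c y *ᵥ x))
    (hrep : ∀ x y, c (c x *ᵥ y) = c x * c y - c y * c x) (k v w : Fin N → ℝ) (n : ℕ) :
    dexpCoeff (n + 1) • (powDeriv (c k) (c w) (n + 1) *ᵥ v - powDeriv (c k) (c v) (n + 1) *ᵥ w)
      = bracketCoeff c k v w n := by
  induction n with
  | zero =>
    have h1 : dexpCoeff 1 = -(1 / 2) := by norm_num [dexpCoeff]
    simp only [powDeriv, bracketCoeff, zero_add, Finset.range_one, Finset.sum_singleton,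
      Finset.Nat.antidiagonal_zero, h1, dexpCoeff_zero]
    simp only [Nat.pred_eq_sub_one, pow_zero, one_mul, mul_one, Matrix.one_mulVec, one_smul,
      Nat.sub_self]
    rw [hanti w v]
    module
  | succ n ih =>
    have h3 : (n : ℝ) + 3 ≠ 0 := by positivity
    refine smul_right_injective _ h3 ?_
    have h4 : ((n : ℝ) + 3) * dexpCoeff (n + 1 + 1) = -dexpCoeff (n + 1) := by
      rw [← succ_mul_dexpCoeff_succ]
      push_cast
      ring
    simp only
    rw [bracketCoeff_succ hrep, ← ih, smul_smul, h4, powDeriv_succ _ _ (n + 1),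
      powDeriv_succ _ _ (n + 1)]
    simp only [Matrix.add_mulVec, Matrix.mulVec_smul, Matrix.mulVec_sub, ← Matrix.mulVec_mulVec]
    rw [hanti ((c k) ^ (n + 1) *ᵥ v) w]
    module

open scoped Matrix.Norms.Operator

/-- The Maurer–Cartan equation for `Y = (1 - exp (-c k)) / c k`. -/
lemma exists_hasFDerivAt_maurerCartan [Nonempty (Fin N)] (hanti : ∀ x y, c x *ᵥ y = -(c y *ᵥ x))
    (hrep : ∀ x y, c (c x *ᵥ y) = c x * c y - c y * c x) (k : Fin N → ℝ)
    {Y : (Fin N → ℝ) → Matrix (Fin N) (Fin N) ℝ}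
    (hY : ∀ k, Y k = ∑' j, dexpCoeff j • (c k) ^ j) :
    ∃ L : (Fin N → ℝ) →L[ℝ] Matrix (Fin N) (Fin N) ℝ, HasFDerivAt Y L k ∧
      ∀ v w, L w *ᵥ v - L v *ᵥ w = c (Y k *ᵥ v) *ᵥ (Y k *ᵥ w) := by
  obtain ⟨L, hL, hsum⟩ := exists_hasFDerivAt_dexpSeries (c k)
  let c' : (Fin N → ℝ) →L[ℝ] Matrix (Fin N) (Fin N) ℝ := LinearMap.toContinuousLinearMap c
  have hYfun : Y = (fun A => ∑' j, dexpCoeff j • A ^ j) ∘ c' := funext hY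
  refine ⟨L.comp c', ?_, fun v w => ?_⟩
  · rw [hYfun]
    exact HasFDerivAt.comp k hL c'.hasFDerivAt
  · let ev : (Fin N → ℝ) → Matrix (Fin N) (Fin N) ℝ →L[ℝ] (Fin N → ℝ) := fun x =>
      LinearMap.toContinuousLinearMap ((Matrix.mulVecBilin ℝ ℝ).flip x)
    have hev : ∀ x A, ev x A = A *ᵥ x := fun x A => rfl
    have hleft : HasSum (fun j => dexpCoeff j •
        (powDeriv (c k) (c w) j *ᵥ v - powDeriv (c k) (c v) j *ᵥ w))
        (L (c w) *ᵥ v - L (c v) *ᵥ w) := by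
      have := ((ev v).hasSum (hsum (c w))).sub ((ev w).hasSum (hsum (c v)))
      simpa only [hev, Matrix.smul_mulVec, smul_sub] using this
    have hleft' := (hasSum_nat_add_iff' 1).2 hleft
    simp only [Finset.range_one, Finset.sum_singleton, powDeriv_zero, Matrix.zero_mulVec, sub_zero, smul_zero] at hleft'
    have hnorm := summable_norm_dexpSeries (c k)
    let cv : Matrix (Fin N) (Fin N) ℝ →L[ℝ] Matrix (Fin N) (Fin N) ℝ := c'.comp (ev v)
    have hcv : ∀ A, cv A = c (A *ᵥ v) := fun A => rfl
    have hprod : HasSum (fun n => ∑ p ∈ Finset.HasAntidiagonal.antidiagonal n,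
        cv (dexpCoeff p.1 • (c k) ^ p.1) * (dexpCoeff p.2 • (c k) ^ p.2)) (cv (Y k) * Y k) := by
      rw [hY]
      exact hasSum_map_mul_antidiagonal hnorm cv
    have hright := (ev w).hasSum hprod
    have hterm : ∀ n, (∑ p ∈ Finset.HasAntidiagonal.antidiagonal n,
        c ((dexpCoeff p.1 • (c k) ^ p.1) *ᵥ v) * (dexpCoeff p.2 • (c k) ^ p.2)) *ᵥ w =
        bracketCoeff c k v w n := by
      intro n
      simp only [bracketCoeff, Matrix.sum_mulVec]
      refine Finset.sum_congr rfl fun p _ => ?_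
      simp only [Matrix.smul_mulVec, map_smul, smul_mul_assoc, mul_smul_comm,
        Matrix.mulVec_mulVec, smul_smul, mul_comm (dexpCoeff p.2)]
    simp only [hev, hcv, hterm, ← Matrix.mulVec_mulVec] at hright
    have hleft'' : HasSum (bracketCoeff c k v w) (L (c w) *ᵥ v - L (c v) *ᵥ w) := by
      simpa only [dexpCoeff_smul_powDeriv_sub hanti hrep] using hleft'
    exact hleft''.unique hright

end AdjointRepresentation

section Determinant

open scoped Matrix.Norms.Operator

lemma differentiable_det {n : Type*} [Fintype n] [DecidableEq n] :
    Differentiable ℝ (fun B : Matrix n n ℝ => B.det) := by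
  have hentry : ∀ i j, Differentiable ℝ (fun B : Matrix n n ℝ => B i j) := fun i j =>
    (LinearMap.toContinuousLinearMap (Matrix.entryLinearMap ℝ ℝ i j)).differentiable
  simp only [Matrix.det_apply']
  fun_prop

/-- Jacobi's formula for the derivative of the determinant at an invertible matrix. -/
lemma fderiv_det_apply {n : Type*} [Fintype n] [DecidableEq n] {A : Matrix n n ℝ}
    (hA : IsUnit A) (H : Matrix n n ℝ) :
    fderiv ℝ (fun B : Matrix n n ℝ => B.det) A H = A.det * (A⁻¹ * H).trace := by
  have hdet : IsUnit A.det := (Matrix.isUnit_iff_isUnit_det A).1 hA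
  have h1 : HasDerivAt (fun t : ℝ => (A + t • H).det)
      (fderiv ℝ (fun B : Matrix n n ℝ => B.det) A H) 0 := by
    have hl : HasDerivAt (fun t : ℝ => A + t • H) H 0 := by
      have h := ((hasDerivAt_id (0 : ℝ)).smul_const H).const_add A
      rw [one_smul] at h
      exact h
    have hd : HasFDerivAt (fun B : Matrix n n ℝ => B.det)
        (fderiv ℝ (fun B : Matrix n n ℝ => B.det) A) (A + (0 : ℝ) • H) := by
      simpa using (differentiable_det A).hasFDerivAt
    exact hd.comp_hasDerivAt (0 : ℝ) hl
  have h2 : HasDerivAt (fun t : ℝ => (A + t • H).det) (A.det * (A⁻¹ * H).trace) 0 := by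
    have hfac : ∀ t : ℝ, (A + t • H).det = A.det * (1 + (A⁻¹ * H).trace * t +
        (Matrix.det (1 + (Polynomial.X : Polynomial ℝ) •
          (A⁻¹ * H).map Polynomial.C)).divX.divX.eval t * t ^ 2) := by
      intro t
      rw [← Matrix.det_one_add_smul, ← Matrix.det_mul, mul_add, mul_one, mul_smul_comm,
        Matrix.mul_nonsing_inv_cancel_left _ _ hdet]
    simp only [hfac]
    generalize (Matrix.det (1 + (Polynomial.X : Polynomial ℝ) •
          (A⁻¹ * H).map Polynomial.C)).divX.divX = p
    have h3 := ((((hasDerivAt_id (0 : ℝ)).const_mul (A⁻¹ * H).trace).const_add 1).add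
      ((p.hasDerivAt 0).mul ((hasDerivAt_id (0 : ℝ)).pow 2))).const_mul A.det
    simpa using! h3
  exact h1.unique h2

lemma fderiv_det_mul_inv_apply {E n : Type*} [NormedAddCommGroup E] [NormedSpace ℝ E]
    [Fintype n] [DecidableEq n] {Y : E → Matrix n n ℝ} {L : E →L[ℝ] Matrix n n ℝ} {k : E}
    (hY : HasFDerivAt Y L k) (hk : IsUnit (Y k)) (i j : n) (w : E) :
    fderiv ℝ (fun k' => (Y k').det * (Y k')⁻¹ i j) k w =
      (Y k).det * (((Y k)⁻¹ * L w).trace * (Y k)⁻¹ i j - ((Y k)⁻¹ * L w * (Y k)⁻¹) i j) := by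
  have hdet : HasFDerivAt (fun k' => (Y k').det)
      ((fderiv ℝ (fun B : Matrix n n ℝ => B.det) (Y k)).comp L) k :=
    HasFDerivAt.comp k (differentiable_det (Y k)).hasFDerivAt hY
  obtain ⟨u, hu⟩ := hk
  have huinv : (↑u⁻¹ : Matrix n n ℝ) = (Y k)⁻¹ := by
    rw [← hu, Matrix.coe_units_inv]
  have hringInv := hasFDerivAt_ringInverse (𝕜 := ℝ) u
  rw [hu, huinv] at hringInv
  have hinv := HasFDerivAt.comp k hringInv hY
  let e : Matrix n n ℝ →L[ℝ] ℝ :=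
    LinearMap.toContinuousLinearMap (Matrix.entryLinearMap ℝ ℝ i j)
  have he : ∀ B, e B = B i j := fun B => rfl
  have hentry := HasFDerivAt.comp k e.hasFDerivAt hinv
  have hprod := hdet.mul hentry
  have hfun : (fun k' => (Y k').det * (Y k')⁻¹ i j) =
      (fun k' => (Y k').det) * (e ∘ (Ring.inverse ∘ Y)) := by
    funext k'
    simp [he, Matrix.nonsing_inv_eq_ringInverse]
  rw [hfun, hprod.fderiv]
  have hfd := fderiv_det_apply ⟨u, hu⟩ (L w)
  have hval : (e.comp ((-(ContinuousLinearMap.mulLeftRight ℝ (Matrix n n ℝ) (Y k)⁻¹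
      (Y k)⁻¹)).comp L)) w = -((Y k)⁻¹ * L w * (Y k)⁻¹) i j := rfl
  have hinvk : (e ∘ (Ring.inverse ∘ Y)) k = (Y k)⁻¹ i j := by
    simp [he, Matrix.nonsing_inv_eq_ringInverse]
  rw [hinvk]
  change (Y k).det * (e.comp ((-(ContinuousLinearMap.mulLeftRight ℝ (Matrix n n ℝ) (Y k)⁻¹
      (Y k)⁻¹)).comp L)) w +
    (Y k)⁻¹ i j * fderiv ℝ (fun B : Matrix n n ℝ => B.det) (Y k) (L w) = _
  rw [hval, hfd]
  ring

end Determinant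

section Trace

lemma trace_eq_zero_of_mul_skew {n : Type*} [Fintype n] [DecidableEq n] {γ A : Matrix n n ℝ}
    (hγsymm : γᵀ = γ) (hγ : IsUnit γ) (hskew : (γ * A)ᵀ = -(γ * A)) : A.trace = 0 := by
  have hdet : IsUnit γ.det := (Matrix.isUnit_iff_isUnit_det γ).1 hγ
  have h : A.trace = -A.trace := by
    calc A.trace = (γ⁻¹ * (γ * A)).trace := by
          rw [Matrix.nonsing_inv_mul_cancel_left _ _ hdet]
      _ = (γ⁻¹ * (γ * A))ᵀ.trace := (Matrix.trace_transpose _).symm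
      _ = -(γ⁻¹ * (γ * A)).trace := by
          rw [Matrix.transpose_mul, hskew, Matrix.transpose_nonsing_inv, hγsymm,
            Matrix.neg_mul, Matrix.trace_neg, Matrix.trace_mul_comm]
      _ = -A.trace := by rw [Matrix.nonsing_inv_mul_cancel_left _ _ hdet]
  linarith

lemma sum_trace_mul_sub_eq_zero {n : Type*} [Fintype n] [DecidableEq n] {Y Z : Matrix n n ℝ}
    (hYZ : Y * Z = 1) {c L : (n → ℝ) →ₗ[ℝ] Matrix n n ℝ} (htrace : ∀ x, (c x).trace = 0)
    (hL : ∀ v w, L w *ᵥ v - L v *ᵥ w = c (Y *ᵥ v) *ᵥ (Y *ᵥ w)) (a : n) :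
    ∑ m, ((Z * L (Pi.single m 1)).trace * Z m a - (Z * L (Pi.single m 1) * Z) m a) = 0 := by
  set x : n → ℝ := Z.col a with hx
  have h1 : ∑ m, (Z * L (Pi.single m 1)).trace * Z m a = (Z * L x).trace := by
    conv_rhs => rw [pi_eq_sum_univ' x]
    simp only [map_sum, map_smul, Matrix.mul_sum, Matrix.trace_sum, mul_smul_comm,
      Matrix.trace_smul, smul_eq_mul]
    refine Finset.sum_congr rfl fun m _ => ?_
    rw [mul_comm]
    rfl
  have h2 : ∀ m, (Z * L (Pi.single m 1) * Z) m a = (Z * (L x + c (Y *ᵥ x) * Y)) m m := by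
    intro m
    have h3 : L (Pi.single m 1) *ᵥ x = (L x + c (Y *ᵥ x) * Y) *ᵥ Pi.single m 1 := by
      rw [Matrix.add_mulVec, ← Matrix.mulVec_mulVec, ← hL]
      abel
    calc (Z * L (Pi.single m 1) * Z) m a = (Z *ᵥ (L (Pi.single m 1) *ᵥ x)) m := by
          rw [Matrix.mulVec_mulVec]; rfl
      _ = _ := by
          rw [h3, Matrix.mulVec_mulVec, Matrix.mulVec_single_one]; rfl
  have h4 : (Z * (c (Y *ᵥ x) * Y)).trace = 0 := by
    rw [Matrix.trace_mul_comm, mul_assoc, hYZ, mul_one, htrace]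
  rw [Finset.sum_sub_distrib, h1, sub_eq_zero]
  simp only [h2]
  change _ = (Z * (L x + c (Y *ᵥ x) * Y)).trace
  rw [mul_add, Matrix.trace_add, h4, add_zero]

end Trace

/-- The right-invariant vector fields `X_A` are divergence-free with respect to
the density `det Y`: `Σ_M ∂_M (det Y · X_A{}^M) = 0` on `U = {k : Y(k) invertible}`. -/
theorem right_invariant_fields_divergence_free
    (N : ℕ)
    (C : Fin N → Fin N → Fin N → ℝ)
    (hCanti : ∀ A B C', C A B C' = -C A C' B)
    (CM : Fin N → Matrix (Fin N) (Fin N) ℝ)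
    (hCM : ∀ A B C', CM A B C' = C B A C')
    (hCC : ∀ A B, CM A * CM B - CM B * CM A = ∑ C', C C' A B • CM C')
    (γ : Matrix (Fin N) (Fin N) ℝ)
    (hγsymm : γᵀ = γ) (hγinv : IsUnit γ)
    (hγC : ∀ A C' D', ∑ B, (γ A B * C B C' D' + γ D' B * C B C' A) = 0)
    (Y : (Fin N → ℝ) → Matrix (Fin N) (Fin N) ℝ)
    (hY : ∀ k, Y k =
      ∑' j : ℕ, ((-1 : ℝ) ^ j / (Nat.factorial (j + 1))) • (∑ A, k A • CM A) ^ j)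
    (U : Set (Fin N → ℝ))
    (hU : U = {k | IsUnit (Y k)})
    (Xe : (Fin N → ℝ) → Fin N → Fin N → ℝ)
    (hXe : ∀ k A M, Xe k A M = (Y k)⁻¹ M A) :
    ∀ A, ∀ k ∈ U,
      ∑ M, partialDeriv' (fun k' => (Y k').det * Xe k' A M) M k = 0 := by
  intro A k hk
  rw [hU] at hk
  have hk' : IsUnit (Y k) := hk
  have : Nonempty (Fin N) := ⟨A⟩
  let c : (Fin N → ℝ) →ₗ[ℝ] Matrix (Fin N) (Fin N) ℝ := Fintype.linearCombination ℝ CM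
  have hc : ∀ x, c x = ∑ B, x B • CM B := fun x => Fintype.linearCombination_apply ℝ CM x
  have hcentry : ∀ x y i, (c x *ᵥ y) i = ∑ D, ∑ B, x B * y D * C i B D := by
    intro x y i
    simp only [hc, Matrix.mulVec, dotProduct, Matrix.sum_apply, Matrix.smul_apply, hCM,
      smul_eq_mul, Finset.sum_mul]
    exact Finset.sum_congr rfl fun D _ => Finset.sum_congr rfl fun B _ => by ring
  have hanti : ∀ x y, c x *ᵥ y = -(c y *ᵥ x) := by
    intro x y
    funext i
    rw [Pi.neg_apply, hcentry, hcentry, Finset.sum_comm, ← Finset.sum_neg_distrib]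
    refine Finset.sum_congr rfl fun B _ => ?_
    rw [← Finset.sum_neg_distrib]
    refine Finset.sum_congr rfl fun D _ => ?_
    rw [hCanti i D B]
    ring
  have hrep : ∀ x y, c (c x *ᵥ y) = c x * c y - c y * c x := by
    intro x y
    have h1 : c x * c y - c y * c x =
        ∑ B, ∑ D, (x B * y D) • (CM B * CM D - CM D * CM B) := by
      rw [hc, hc, Finset.sum_mul_sum, Finset.sum_mul_sum,
        Finset.sum_comm (s := Finset.univ) (f := fun D B => (y D • CM D) * (x B • CM B)),
        ← Finset.sum_sub_distrib]
      refine Finset.sum_congr rfl fun B _ => ?_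
      rw [← Finset.sum_sub_distrib]
      refine Finset.sum_congr rfl fun D _ => ?_
      rw [smul_mul_smul_comm, smul_mul_smul_comm, smul_sub, mul_comm (y D)]
    rw [h1, hc]
    simp only [hCC, hcentry, Finset.smul_sum, Finset.sum_smul, smul_smul]
    exact Finset.sum_comm.trans ((Finset.sum_congr rfl fun D _ => Finset.sum_comm).trans
      Finset.sum_comm)
  have htrace : ∀ x, (c x).trace = 0 := by
    intro x
    rw [hc, Matrix.trace_sum]
    refine Finset.sum_eq_zero fun B _ => ?_
    rw [Matrix.trace_smul, trace_eq_zero_of_mul_skew hγsymm hγinv, smul_zero]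
    ext i j
    have h := hγC j B i
    simp only [← hCM, Finset.sum_add_distrib] at h
    simp only [Matrix.transpose_apply, Matrix.neg_apply, Matrix.mul_apply]
    linarith
  have hYc : ∀ k, Y k = ∑' j, dexpCoeff j • (c k) ^ j := by
    intro k
    rw [hY, hc]
    rfl
  obtain ⟨L, hL, hMC⟩ := exists_hasFDerivAt_maurerCartan hanti hrep k hYc
  have hdet : IsUnit (Y k).det := (Matrix.isUnit_iff_isUnit_det _).1 hk'
  simp only [hXe, partialDeriv', fderiv_det_mul_inv_apply hL hk']
  rw [← Finset.mul_sum]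
  have hsum := sum_trace_mul_sub_eq_zero (Matrix.mul_nonsing_inv _ hdet)
    (L := (L : (Fin N → ℝ) →ₗ[ℝ] Matrix (Fin N) (Fin N) ℝ)) htrace hMC A
  exact mul_eq_zero_of_right _ hsum
end
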